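/- Fix an integer d ≥ 5. Let Q be a finite simple graph whose vertex set is K ∪ {s₁, s₂}, where s₁ and s₂ are two distinct vertices not in K, the induced subgraph Q[K] is a clique on d vertices, and: (1) there exists a vertex v ∈ K adjacent to both s₁ and s₂; (2) each of s₁ and s₂ has at least 5 neighbors in K; (3) there exist two distinct vertices a₁, a₂ ∈ K such that a₁ is not adjacent to s₁ and a₂ is not adjacent to s₂. Then Q is (deg−1)-choosable. This holds whether or not the edge {s₁, s₂} is present in Q. -/

import Mathlib

section

open Finset

/-- The colors left in the list of `w` once `c` is forbidden on `N` and `c'` is forbidden on `M`. -/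
def remainingColors {ι : Type*} [DecidableEq ι] (L : ι → Finset ℕ) (N M : Finset ι) (c c' : ℕ)
    (w : ι) : Finset ℕ :=
  (L w).filter fun x => (w ∈ N → x ≠ c) ∧ (w ∈ M → x ≠ c')

section

variable {ι : Type*} [DecidableEq ι] {L : ι → Finset ℕ} {N M : Finset ι} {d : ℕ}

lemma remainingColors_comm (L : ι → Finset ℕ) (N M : Finset ι) (c c' : ℕ) (w : ι) :
    remainingColors L N M c c' w = remainingColors L M N c' c w := by
  simp [remainingColors, and_comm]

lemma mem_remainingColors {c c' x : ℕ} {w : ι} :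
    x ∈ remainingColors L N M c c' w ↔ x ∈ L w ∧ (w ∈ N → x ≠ c) ∧ (w ∈ M → x ≠ c') := by
  simp [remainingColors]

lemma card_list_le_card_remainingColors (c c' : ℕ) (w : ι) :
    (L w).card ≤ (remainingColors L N M c c' w).card +
      (if w ∈ N ∧ c ∈ L w then 1 else 0) + (if w ∈ M then 1 else 0) := by
  have hsub : L w ⊆ remainingColors L N M c c' w ∪
      (if w ∈ N ∧ c ∈ L w then {c} else ∅) ∪ (if w ∈ M then {c'} else ∅) := by
    intro x hx
    simp only [mem_union, mem_remainingColors]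
    by_cases hN : w ∈ N <;> by_cases hM : w ∈ M <;> by_cases hc : x = c <;>
      by_cases hc' : x = c' <;> simp_all
  refine (card_le_card hsub).trans ((card_union_le _ _).trans ?_)
  refine Nat.add_le_add ((card_union_le _ _).trans (Nat.add_le_add le_rfl ?_)) ?_ <;>
    split_ifs <;> simp

/-- The color `c`, forbidden on `N`, leaves no room for an obstruction to Hall's condition
of the form that all vertices but `u` have the same `d - 2` remaining colors, unless `u = a`. -/
def AvoidsConstantLists (L : ι → Finset ℕ) (N M : Finset ι) (d : ℕ) (a : ι) (c : ℕ) : Prop :=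
  ∀ c', c' ≠ c → ∀ u, u ≠ a → ∀ W : Finset ℕ, W.card + 2 ≤ d →
    ¬ ∀ w, w ≠ u → remainingColors L N M c c' w = W

lemma mem_list_of_remainingColors_eq
    (hL : ∀ w, (L w).card + 2 = d + (if w ∈ N then 1 else 0) + (if w ∈ M then 1 else 0))
    {c c' : ℕ} {w : ι} (hw : w ∈ N) {W : Finset ℕ} (hW : W.card + 2 ≤ d)
    (h : remainingColors L N M c c' w = W) : c ∈ L w := by
  by_contra hc
  have h1 := hL w
  have h2 := card_list_le_card_remainingColors (L := L) (N := N) (M := M) c c' w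
  rw [h] at h2
  simp only [hw, hc, if_true, and_false, if_false] at h1 h2
  omega

lemma avoidsConstantLists_of_mem {a : ι} (ha : a ∉ N) (hN : 5 ≤ N.card) {c : ℕ}
    (hc : c ∈ L a) : AvoidsConstantLists L N M d a c := by
  intro c' hcc' u hu W _ h
  obtain ⟨w, hwN, hwu⟩ := exists_mem_ne (by omega : 1 < N.card) u
  have hcW : c ∈ W := by
    rw [← h a hu.symm, mem_remainingColors]
    exact ⟨hc, fun h => absurd h ha, fun _ => hcc'.symm⟩
  rw [← h w hwu, mem_remainingColors] at hcW
  exact hcW.2.1 hwN rfl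

lemma avoidsConstantLists_of_missing
    (hL : ∀ w, (L w).card + 2 = d + (if w ∈ N then 1 else 0) + (if w ∈ M then 1 else 0))
    {a : ι} {c : ℕ} (hc : 1 < (N.filter fun w => c ∉ L w).card) :
    AvoidsConstantLists L N M d a c := by
  intro c' _ u _ W hW h
  obtain ⟨w, hw, hwu⟩ := exists_mem_ne hc u
  rw [mem_filter] at hw
  exact hw.2 (mem_list_of_remainingColors_eq hL hw.1 hW (h w hwu))

lemma exists_avoidsConstantLists_of_disjoint
    (hL : ∀ w, (L w).card + 2 = d + (if w ∈ N then 1 else 0) + (if w ∈ M then 1 else 0))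
    {a : ι} (hN : 5 ≤ N.card) {P : Finset ℕ} (hP : 3 ≤ P.card) (hdisj : ∀ c ∈ P, c ∉ L a) :
    ∃ c ∈ P, AvoidsConstantLists L N M d a c := by
  by_cases hmiss : ∃ c ∈ P, 1 < (N.filter fun w => c ∉ L w).card
  · obtain ⟨c, hcP, hc⟩ := hmiss
    exact ⟨c, hcP, avoidsConstantLists_of_missing hL hc⟩
  push Not at hmiss
  obtain ⟨x, y, z, hx, hy, hz, hxy, hxz, hyz⟩ := two_lt_card_iff.1 (by omega : 2 < P.card)
  refine ⟨x, hx, fun c' _ u hu W _ h => ?_⟩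
  obtain ⟨w, hwN, hw⟩ : ∃ w ∈ N, w ∉ (N.filter fun w => x ∉ L w) ∪ (N.filter fun w => y ∉ L w) ∪
      (N.filter fun w => z ∉ L w) ∪ {u} := by
    refine exists_mem_notMem_of_card_lt_card (lt_of_le_of_lt (card_union_le _ _) ?_)
    have h1 := card_union_le ((N.filter fun w => x ∉ L w) ∪ (N.filter fun w => y ∉ L w))
      (N.filter fun w => z ∉ L w)
    have h2 := card_union_le (N.filter fun w => x ∉ L w) (N.filter fun w => y ∉ L w)
    have := hmiss x hx
    have := hmiss y hy
    have := hmiss z hz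
    rw [card_singleton]
    omega
  simp only [mem_union, mem_filter, mem_singleton, hwN, true_and, not_or, not_not] at hw
  obtain ⟨⟨⟨_, hwy⟩, hwz⟩, hwu⟩ := hw
  have key : ∀ t ∈ P, t ≠ x → t ∈ L w → t = c' := by
    intro t ht htx htw
    by_contra htc
    have : t ∈ remainingColors L N M x c' w :=
      mem_remainingColors.2 ⟨htw, fun _ => htx, fun _ => htc⟩
    rw [h w hwu, ← h a hu.symm, mem_remainingColors] at this
    exact hdisj t ht this.1
  exact hyz ((key y hy hxy.symm hwy).trans (key z hz hxz.symm hwz).symm)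

/-- Among `k ≥ 3` colors there is one which avoids constant lists and which, when forbidden
on `N`, either still occurs in a list outside `N`, or occurs in no list, or there are at least
`d + k - 2` colors in total. -/
lemma exists_avoidsConstantLists [Fintype ι]
    (hL : ∀ w, (L w).card + 2 = d + (if w ∈ N then 1 else 0) + (if w ∈ M then 1 else 0))
    {a : ι} (ha : a ∉ N) (hN : 5 ≤ N.card) {P : Finset ℕ} (hP : 3 ≤ P.card) :
    ∃ c ∈ P, AvoidsConstantLists L N M d a c ∧
      ((c ∈ univ.biUnion L → ∃ w ∉ N, c ∈ L w) ∨
        d + P.card ≤ (univ.biUnion L).card + 2) := by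
  by_cases hE : ∃ c ∈ P, c ∈ L a
  · obtain ⟨c, hcP, hc⟩ := hE
    exact ⟨c, hcP, avoidsConstantLists_of_mem ha hN hc, .inl fun _ => ⟨a, ha, hc⟩⟩
  push Not at hE
  by_cases hU : ∃ c ∈ P, c ∉ univ.biUnion L
  · obtain ⟨c, hcP, hc⟩ := hU
    refine ⟨c, hcP, avoidsConstantLists_of_missing hL ?_, .inl fun h => absurd h hc⟩
    rw [filter_true_of_mem]
    · omega
    · exact fun w _ hw => hc (mem_biUnion.2 ⟨w, mem_univ w, hw⟩)
  push Not at hU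
  obtain ⟨c, hcP, hc⟩ := exists_avoidsConstantLists_of_disjoint hL hN hP hE
  refine ⟨c, hcP, hc, .inr ?_⟩
  have hsub : P ∪ L a ⊆ univ.biUnion L :=
    union_subset hU (subset_biUnion_of_mem L (mem_univ a))
  have h1 := card_le_card hsub
  rw [card_union_of_disjoint (disjoint_left.2 hE)] at h1
  have h2 := hL a
  omega

/-- If `c₁`, `c₂` avoid constant lists and few colors get lost, the clique can be colored. -/
lemma exists_injective_remainingColors [Fintype ι] (hd : Fintype.card ι = d)
    (hL : ∀ w, (L w).card + 2 = d + (if w ∈ N then 1 else 0) + (if w ∈ M then 1 else 0))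
    {a₁ a₂ : ι} (ha : a₁ ≠ a₂) {c₁ c₂ : ℕ} (hc : c₁ ≠ c₂)
    (h₁ : AvoidsConstantLists L N M d a₁ c₁) (h₂ : AvoidsConstantLists L M N d a₂ c₂)
    (hU : d ≤ (univ.biUnion (remainingColors L N M c₁ c₂)).card) :
    ∃ f : ι → ℕ, Function.Injective f ∧ ∀ w, f w ∈ remainingColors L N M c₁ c₂ w := by
  have hcard : ∀ w, d ≤ (remainingColors L N M c₁ c₂ w).card + 2 := by
    intro w
    have h1 := hL w
    have h2 := card_list_le_card_remainingColors (L := L) (N := N) (M := M) c₁ c₂ w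
    split_ifs at h1 h2 <;> first | omega | simp_all
  rw [← all_card_le_biUnion_card_iff_exists_injective]
  intro s
  by_contra! hs
  obtain ⟨w₀, hw₀⟩ : s.Nonempty := card_pos.1 (by omega)
  have hle : ∀ w ∈ s, (remainingColors L N M c₁ c₂ w).card ≤
      (s.biUnion (remainingColors L N M c₁ c₂)).card :=
    fun w hw => card_le_card (subset_biUnion_of_mem _ hw)
  have hsd : s.card ≤ d := hd ▸ card_le_univ s
  have h0 := hle w₀ hw₀
  have h0' := hcard w₀
  obtain hsd | hsd : s.card = d ∨ s.card + 1 = d := by omega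
  · rw [eq_univ_of_card s (hsd.trans hd.symm)] at hs
    rw [card_univ] at hs
    omega
  · obtain ⟨u, hu⟩ : ∃ u, sᶜ = {u} := by
      rw [← card_eq_one, card_compl]
      omega
    have hconst : ∀ w, w ≠ u → remainingColors L N M c₁ c₂ w =
        s.biUnion (remainingColors L N M c₁ c₂) := by
      intro w hw
      have hws : w ∈ s := by
        by_contra hws
        exact hw (mem_singleton.1 (hu ▸ mem_compl.2 hws))
      refine eq_of_subset_of_card_le (subset_biUnion_of_mem _ hws) ?_
      have := hcard w
      omega
    have hu₁ : u = a₁ := by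
      by_contra hne
      exact h₁ c₂ hc.symm u hne (s.biUnion (remainingColors L N M c₁ c₂)) (by omega) hconst
    have hu₂ : u = a₂ := by
      by_contra hne
      refine h₂ c₁ hc u hne (s.biUnion (remainingColors L N M c₁ c₂)) (by omega) fun w hw => ?_
      rw [← remainingColors_comm]
      exact hconst w hw
    exact ha (hu₁.symm.trans hu₂)

/-- Coloring a clique together with two extra vertices with neighborhoods `N` and `M`
and color lists `S₁` and `S₂`. -/
lemma exists_coloring_clique_add_two [Fintype ι] (hd : Fintype.card ι = d)
    (hL : ∀ w, (L w).card + 2 = d + (if w ∈ N then 1 else 0) + (if w ∈ M then 1 else 0))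
    (hN : 5 ≤ N.card) (hM : 5 ≤ M.card) {v : ι} (hvN : v ∈ N) (hvM : v ∈ M)
    {a₁ a₂ : ι} (ha : a₁ ≠ a₂) (ha₁ : a₁ ∉ N) (ha₂ : a₂ ∉ M)
    {S₁ S₂ : Finset ℕ} (hS₁ : 4 ≤ S₁.card) (hS₂ : 4 ≤ S₂.card) :
    ∃ c₁ ∈ S₁, ∃ c₂ ∈ S₂, c₁ ≠ c₂ ∧
      ∃ f : ι → ℕ, Function.Injective f ∧ ∀ w, f w ∈ remainingColors L N M c₁ c₂ w := by
  have hL' : ∀ w, (L w).card + 2 =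
      d + (if w ∈ M then 1 else 0) + (if w ∈ N then 1 else 0) := by
    intro w
    rw [hL w]
    omega
  obtain ⟨c₁, hc₁, hfine₁, hlost₁⟩ :=
    exists_avoidsConstantLists hL ha₁ hN (by omega : 3 ≤ S₁.card)
  have hS₂' : 3 ≤ (S₂.erase c₁).card := by
    have := pred_card_le_card_erase (s := S₂) (a := c₁)
    omega
  obtain ⟨c₂, hc₂, hfine₂, hlost₂⟩ := exists_avoidsConstantLists hL' ha₂ hM hS₂'
  obtain ⟨hne, hc₂⟩ := mem_erase.1 hc₂
  refine ⟨c₁, hc₁, c₂, hc₂, hne.symm, exists_injective_remainingColors hd hL ha hne.symm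
    hfine₁ hfine₂ ?_⟩
  have hUd : d ≤ (univ.biUnion L).card := by
    have h1 := hL v
    have h2 := card_le_card (subset_biUnion_of_mem L (mem_univ v))
    simp only [hvN, hvM, if_true] at h1
    omega
  have hmem : ∀ x ∈ univ.biUnion L, (x = c₁ → ∃ w ∉ N, c₁ ∈ L w) → (x = c₂ → ∃ w ∉ M, c₂ ∈ L w) →
      x ∈ univ.biUnion (remainingColors L N M c₁ c₂) := by
    intro x hx h1 h2
    simp only [mem_biUnion, mem_univ, true_and, mem_remainingColors] at hx ⊢
    by_cases hx1 : x = c₁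
    · obtain ⟨w, hwN, hw⟩ := h1 hx1
      exact ⟨w, hx1 ▸ hw, fun h => absurd h hwN, fun _ => hx1 ▸ hne.symm⟩
    by_cases hx2 : x = c₂
    · obtain ⟨w, hwM, hw⟩ := h2 hx2
      exact ⟨w, hx2 ▸ hw, fun _ => hx1, fun h => absurd h hwM⟩
    · obtain ⟨w, hw⟩ := hx
      exact ⟨w, hw, fun _ => hx1, fun _ => hx2⟩
  have hbound : ∀ T : Finset ℕ, (∀ x ∈ univ.biUnion L, x ∉ T →
      x ∈ univ.biUnion (remainingColors L N M c₁ c₂)) →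
      (univ.biUnion L).card ≤ (univ.biUnion (remainingColors L N M c₁ c₂)).card + T.card := by
    intro T hT
    refine (card_le_card fun x hx => ?_).trans (card_union_le _ _)
    by_cases hxT : x ∈ T
    · exact mem_union_right _ hxT
    · exact mem_union_left _ (hT x hx hxT)
  rcases hlost₁ with h1 | h1
  · rcases hlost₂ with h2 | h2
    · have := hbound ∅ fun x hx _ =>
        hmem x hx (fun h => h1 (h ▸ hx)) (fun h => h2 (h ▸ hx))
      rw [card_empty] at this
      omega
    · have := hbound {c₂} fun x hx hxT =>
        hmem x hx (fun h => h1 (h ▸ hx)) (fun h => absurd (mem_singleton.2 h) hxT)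
      rw [card_singleton] at this
      omega
  · have := hbound {c₁, c₂} fun x hx hxT =>
      hmem x hx (fun h => absurd (by simp [h]) hxT) (fun h => absurd (by simp [h]) hxT)
    have := card_le_two (a := c₁) (b := c₂)
    omega

end

lemma degree_eq_of_isClique {V : Type*} [Fintype V] [DecidableEq V]
    (Q : SimpleGraph V) [DecidableRel Q.Adj] (K : Finset V) (s₁ s₂ : V) (hs : s₁ ≠ s₂)
    (hs₁ : s₁ ∉ K) (hs₂ : s₂ ∉ K) (hV : insert s₁ (insert s₂ K) = (univ : Finset V))
    (hK : Q.IsClique (K : Set V)) {w : V} (hw : w ∈ K) :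
    Q.degree w + 1 = K.card + (if Q.Adj s₁ w then 1 else 0) + (if Q.Adj s₂ w then 1 else 0) := by
  have hfilter : K.filter (Q.Adj w) = K.erase w := by
    ext x
    simp only [mem_filter, mem_erase]
    constructor
    · rintro ⟨hx, h⟩
      exact ⟨h.ne', hx⟩
    · rintro ⟨hne, hx⟩
      exact ⟨hx, hK hw hx hne.symm⟩
  have hcard := card_erase_add_one hw
  rw [← SimpleGraph.card_neighborFinset_eq_degree, SimpleGraph.neighborFinset_eq_filter, ← hV,
    filter_insert, filter_insert, hfilter]
  simp only [Q.adj_comm w]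
  split_ifs <;>
    simp [card_insert_of_notMem, hs, hs₁, hs₂] <;> omega

lemma card_filter_le_degree {V : Type*} [Fintype V]
    (Q : SimpleGraph V) [DecidableRel Q.Adj] (K : Finset V) (s : V) :
    (K.filter fun w => Q.Adj s w).card ≤ Q.degree s := by
  rw [← SimpleGraph.card_neighborFinset_eq_degree, SimpleGraph.neighborFinset_eq_filter]
  exact card_le_card (filter_subset_filter _ (subset_univ K))

lemma card_filter_le_card_filter_subtype {V : Type*} [DecidableEq V] (K : Finset V) (p : V → Prop)
    [DecidablePred p] :
    (K.filter p).card ≤ (univ.filter fun w : {x // x ∈ K} => p w).card := by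
  refine (card_le_card fun x hx => ?_).trans (card_image_le (f := Subtype.val))
  obtain ⟨hxK, hx⟩ := mem_filter.1 hx
  exact mem_image.2 ⟨⟨x, hxK⟩, by simpa using hx, rfl⟩

end

/-- Fix `d ≥ 5`. Let `Q` be a finite simple graph whose vertex set is
`K ∪ {s₁, s₂}` with `s₁ ≠ s₂` not in `K`, where `Q[K]` is a clique on `d` vertices, and:
(1) some `v ∈ K` is adjacent to both `s₁` and `s₂`;
(2) each of `s₁`, `s₂` has at least `5` neighbors in `K`;
(3) there are distinct `a₁, a₂ ∈ K` with `a₁` non-adjacent to `s₁` and `a₂` non-adjacent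
to `s₂`.
Then `Q` is `(deg − 1)`-choosable: for every assignment of a finite list `L v` of colors
with `|L v| = deg v − 1` to each vertex `v`, there is a proper coloring `φ` of `Q` with
`φ v ∈ L v` for every `v`.  (No assumption is made about the edge `{s₁, s₂}`.) -/
theorem popular_deg_minus_one_choosable
    {V : Type*} [Fintype V] [DecidableEq V] (d : ℕ) (hd : 5 ≤ d)
    (Q : SimpleGraph V) [DecidableRel Q.Adj]
    (K : Finset V) (s₁ s₂ : V) (hs : s₁ ≠ s₂) (hs₁ : s₁ ∉ K) (hs₂ : s₂ ∉ K)
    (hV : insert s₁ (insert s₂ K) = (Finset.univ : Finset V))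
    (hKcard : K.card = d) (hKclique : Q.IsClique (K : Set V))
    (h1 : ∃ v ∈ K, Q.Adj v s₁ ∧ Q.Adj v s₂)
    (h2 : 5 ≤ (K.filter fun w => Q.Adj s₁ w).card)
    (h3 : 5 ≤ (K.filter fun w => Q.Adj s₂ w).card)
    (h4 : ∃ a₁ ∈ K, ∃ a₂ ∈ K, a₁ ≠ a₂ ∧ ¬ Q.Adj s₁ a₁ ∧ ¬ Q.Adj s₂ a₂) :
    ∀ L : V → Finset ℕ, (∀ v, (L v).card = Q.degree v - 1) →
      ∃ φ : V → ℕ, (∀ v, φ v ∈ L v) ∧ ∀ a b, Q.Adj a b → φ a ≠ φ b := by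
  intro L hL
  obtain ⟨v, hvK, hv₁, hv₂⟩ := h1
  obtain ⟨a₁, ha₁K, a₂, ha₂K, ha, ha₁, ha₂⟩ := h4
  have hLK : ∀ w : {x // x ∈ K}, (L w).card + 2 =
      d + (if w ∈ (Finset.univ.filter fun w : {x // x ∈ K} => Q.Adj s₁ w) then 1 else 0) +
        (if w ∈ (Finset.univ.filter fun w : {x // x ∈ K} => Q.Adj s₂ w) then 1 else 0) := by
    intro w
    have h := degree_eq_of_isClique Q K s₁ s₂ hs hs₁ hs₂ hV hKclique w.2
    rw [hL w]
    simp only [Finset.mem_filter, Finset.mem_univ, true_and]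
    omega
  have hS₁ := hL s₁
  have hS₂ := hL s₂
  have hdeg₁ := card_filter_le_degree Q K s₁
  have hdeg₂ := card_filter_le_degree Q K s₂
  obtain ⟨c₁, hc₁, c₂, hc₂, hne, f, hinj, hf⟩ :=
    exists_coloring_clique_add_two (L := fun w : {x // x ∈ K} => L w)
      (by simpa using hKcard) hLK
      (h2.trans (card_filter_le_card_filter_subtype K _))
      (h3.trans (card_filter_le_card_filter_subtype K _))
      (v := ⟨v, hvK⟩) (by simpa using hv₁.symm) (by simpa using hv₂.symm)
      (a₁ := ⟨a₁, ha₁K⟩) (a₂ := ⟨a₂, ha₂K⟩) (by simpa using ha) (by simpa using ha₁)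
      (by simpa using ha₂) (by omega : 4 ≤ (L s₁).card) (by omega : 4 ≤ (L s₂).card)
  simp only [mem_remainingColors, Finset.mem_filter, Finset.mem_univ, true_and] at hf
  have hcases : ∀ w, w = s₁ ∨ w = s₂ ∨ w ∈ K := by
    intro w
    simpa [← hV] using Finset.mem_univ w
  obtain ⟨φ, hφ₁, hφ₂, hφK⟩ : ∃ φ : V → ℕ, φ s₁ = c₁ ∧ φ s₂ = c₂ ∧
      ∀ w (hw : w ∈ K), φ w = f ⟨w, hw⟩ := by
    refine ⟨fun w => if hw : w ∈ K then f ⟨w, hw⟩ else if w = s₁ then c₁ else c₂, ?_, ?_, ?_⟩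
    · simp [hs₁]
    · simp [hs₂, hs.symm]
    · intro w hw
      simp [hw]
  refine ⟨φ, fun w => ?_, fun x y hxy => ?_⟩
  · rcases hcases w with rfl | rfl | hw
    · rwa [hφ₁]
    · rwa [hφ₂]
    · rw [hφK w hw]
      exact (hf ⟨w, hw⟩).1
  · rcases hcases x with rfl | rfl | hx <;> rcases hcases y with rfl | rfl | hy
    · exact absurd hxy Q.irrefl
    · rwa [hφ₁, hφ₂]
    · rw [hφ₁, hφK y hy]
      exact ((hf ⟨y, hy⟩).2.1 hxy).symm
    · rw [hφ₁, hφ₂]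
      exact hne.symm
    · exact absurd hxy Q.irrefl
    · rw [hφ₂, hφK y hy]
      exact ((hf ⟨y, hy⟩).2.2 hxy).symm
    · rw [hφ₁, hφK x hx]
      exact (hf ⟨x, hx⟩).2.1 hxy.symm
    · rw [hφ₂, hφK x hx]
      exact (hf ⟨x, hx⟩).2.2 hxy.symm
    · rw [hφK x hx, hφK y hy]
      exact fun h => hxy.ne (congrArg Subtype.val (hinj h))
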